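/- Fix a real a > 1, an integer r ≥ 1 with a − 1 ≤ r, and an integer m ≥ 1. For a tuple (c_1,…,c_{k−1}) of elements of {0,1,…,r} and c ∈ {0,1,…,r−1}, the intersection Δ_{c_1…c_{k−1}c} ∩ Δ_{c_1…c_{k−1}(c+1)} equals the single rank-(k+m) cylinder Δ_{c_1…c_{k−1}c r…r} (with m copies of the digit r appended; equivalently Δ_{c_1…c_{k−1}(c+1)0…0} with m copies of 0 appended) if and only if r = a^m (a−1)/(a^m − 1). -/

import Mathlib

/-- The `r_a`-cylinder of rank `k` with base `(c 0, …, c (k-1))`. -/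
def raCylinder (a : ℝ) (r k : ℕ) (c : ℕ → ℕ) : Set ℝ :=
  {x : ℝ | ∃ α : ℕ → ℕ, (∀ n, α n ≤ r) ∧
    x = (∑ i ∈ Finset.range k, (c i : ℝ) / a ^ (i + 1)) +
        ∑' n : ℕ, (α n : ℝ) / a ^ (k + n + 1)}

open Finset Filter Topology

theorem hasSum_const_div_pow {a : ℝ} (ha : 1 < a) (b : ℝ) (k : ℕ) :
    HasSum (fun n : ℕ => b / a ^ (k + n + 1)) (b / (a ^ k * (a - 1))) := by
  have h0 : 0 < a := by linarith
  have h1 : a - 1 ≠ 0 := by linarith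
  have h2 : 1 - a⁻¹ = (a - 1) / a := by field_simp
  have h := (hasSum_geometric_of_lt_one (inv_nonneg.2 h0.le)
    (inv_lt_one_of_one_lt₀ ha)).mul_left (b / a ^ (k + 1))
  have hterm : ∀ n : ℕ, b / a ^ (k + 1) * a⁻¹ ^ n = b / a ^ (k + n + 1) := fun n => by
    rw [inv_pow, ← div_eq_mul_inv, div_div, ← pow_add]
    congr 2
    ring
  have hval : b / a ^ (k + 1) * (1 - a⁻¹)⁻¹ = b / (a ^ k * (a - 1)) := by
    rw [h2]
    field_simp
    ring
  rw [hval] at h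
  simpa only [hterm] using h

/-- The greedy digit of `y` in base `a`, truncated at `r`. -/
noncomputable def greedyDigit (a : ℝ) (r : ℕ) (y : ℝ) : ℕ := min r ⌊a * y⌋₊

/-- The remainders of the greedy expansion of `y`. -/
noncomputable def greedyRemainder (a : ℝ) (r : ℕ) (y : ℝ) : ℕ → ℝ
  | 0 => y
  | n + 1 => a * greedyRemainder a r y n - greedyDigit a r (greedyRemainder a r y n)

theorem greedyRemainder_mem_Icc {a : ℝ} (ha : 1 < a) {r : ℕ} (har : a - 1 ≤ r) {y : ℝ}
    (hy : y ∈ Set.Icc 0 ((r : ℝ) / (a - 1))) (n : ℕ) :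
    greedyRemainder a r y n ∈ Set.Icc 0 ((r : ℝ) / (a - 1)) := by
  have h1 : 0 < a - 1 := by linarith
  induction n with
  | zero => exact hy
  | succ n ih =>
    simp only [greedyRemainder, greedyDigit]
    generalize greedyRemainder a r y n = z at ih
    obtain ⟨hz0, hz⟩ := ih
    have haz : 0 ≤ a * z := mul_nonneg (by linarith) hz0
    have hone : 1 ≤ (r : ℝ) / (a - 1) := (one_le_div h1).2 har
    have hfl := Nat.floor_le haz
    rcases le_total r ⌊a * z⌋₊ with h | h
    · rw [min_eq_left h]
      have hr : (r : ℝ) ≤ ⌊a * z⌋₊ := by exact_mod_cast h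
      have hstep : a * ((r : ℝ) / (a - 1)) - r = r / (a - 1) := by field_simp; ring
      have := mul_le_mul_of_nonneg_left hz (by linarith : 0 ≤ a)
      constructor <;> linarith
    · rw [min_eq_right h]
      have := Nat.lt_floor_add_one (a * z)
      constructor <;> linarith

theorem sum_greedyDigit_add {a : ℝ} (ha : 1 < a) (r : ℕ) (y : ℝ) (n : ℕ) :
    ∑ i ∈ range n, (greedyDigit a r (greedyRemainder a r y i) : ℝ) / a ^ (i + 1) =
      y - greedyRemainder a r y n / a ^ n := by
  have h0 : 0 < a := by linarith
  induction n with
  | zero => simp [greedyRemainder]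
  | succ n ih =>
    rw [sum_range_succ, ih, greedyRemainder]
    field_simp
    ring

theorem hasSum_greedyDigit {a : ℝ} (ha : 1 < a) {r : ℕ} (har : a - 1 ≤ r) {y : ℝ}
    (hy : y ∈ Set.Icc 0 ((r : ℝ) / (a - 1))) :
    HasSum (fun n => (greedyDigit a r (greedyRemainder a r y n) : ℝ) / a ^ (n + 1)) y := by
  have h0 : 0 < a := by linarith
  rw [hasSum_iff_tendsto_nat_of_nonneg (fun n => by positivity)]
  simp only [sum_greedyDigit_add ha]
  have hlim : Tendsto (fun n : ℕ => (r : ℝ) / (a - 1) / a ^ n) atTop (𝓝 0) :=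
    (tendsto_pow_atTop_atTop_of_one_lt ha).const_div_atTop _
  have hrem : Tendsto (fun n : ℕ => greedyRemainder a r y n / a ^ n) atTop (𝓝 0) := by
    refine squeeze_zero (fun n => ?_) (fun n => ?_) hlim
    · exact div_nonneg (greedyRemainder_mem_Icc ha har hy n).1 (by positivity)
    · exact div_le_div_of_nonneg_right (greedyRemainder_mem_Icc ha har hy n).2 (by positivity)
  simpa using hrem.const_sub y

theorem raCylinder_eq_Icc {a : ℝ} (ha : 1 < a) {r : ℕ} (har : a - 1 ≤ r) (k : ℕ) (c : ℕ → ℕ) :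
    raCylinder a r k c =
      Set.Icc (∑ i ∈ range k, (c i : ℝ) / a ^ (i + 1))
        (∑ i ∈ range k, (c i : ℝ) / a ^ (i + 1) + r / (a ^ k * (a - 1))) := by
  have h0 : 0 < a := by linarith
  have h1 : 0 < a - 1 := by linarith
  ext x
  simp only [raCylinder, Set.mem_ofPred_eq, Set.mem_Icc]
  set S := ∑ i ∈ range k, (c i : ℝ) / a ^ (i + 1)
  constructor
  · rintro ⟨α, hα, rfl⟩
    have hr := hasSum_const_div_pow ha r k
    have hle : ∀ n, (α n : ℝ) / a ^ (k + n + 1) ≤ r / a ^ (k + n + 1) := fun n =>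
      div_le_div_of_nonneg_right (by exact_mod_cast hα n) (by positivity)
    have hα0 : ∀ n, 0 ≤ (α n : ℝ) / a ^ (k + n + 1) := fun n => by positivity
    have hs := Summable.of_nonneg_of_le hα0 hle hr.summable
    have hup := hasSum_le hle hs.hasSum hr
    have hlow : 0 ≤ ∑' n, (α n : ℝ) / a ^ (k + n + 1) := tsum_nonneg hα0
    constructor <;> linarith
  · rintro ⟨hl, hu⟩
    have hy : (x - S) * a ^ k ∈ Set.Icc 0 ((r : ℝ) / (a - 1)) := by
      refine ⟨mul_nonneg (by linarith) (by positivity), ?_⟩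
      rw [← le_div_iff₀ (by positivity), div_div, mul_comm (a - 1)]
      linarith
    refine ⟨fun n => greedyDigit a r (greedyRemainder a r ((x - S) * a ^ k) n),
      fun n => min_le_left _ _, ?_⟩
    have h := ((hasSum_greedyDigit ha har hy).div_const (a ^ k)).tsum_eq
    rw [mul_div_cancel_right₀ _ (by positivity)] at h
    have hcongr : ∀ n, (greedyDigit a r (greedyRemainder a r ((x - S) * a ^ k) n) : ℝ) /
        a ^ (n + 1) / a ^ k =
        greedyDigit a r (greedyRemainder a r ((x - S) * a ^ k) n) / a ^ (k + n + 1) := fun n => by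
      rw [div_div, ← pow_add]
      congr 2
      ring
    simp only [hcongr] at h
    rw [h]
    ring

theorem sum_range_const_div_pow {a : ℝ} (ha : 1 < a) (b : ℝ) (k m : ℕ) :
    ∑ i ∈ range m, b / a ^ (k + i + 1) =
      b / (a ^ k * (a - 1)) - b / (a ^ (k + m) * (a - 1)) := by
  have h0 : 0 < a := by linarith
  have h1 : a - 1 ≠ 0 := by linarith
  induction m with
  | zero => simp
  | succ m ih =>
    rw [sum_range_succ, ih]
    field_simp
    ring

/-- For `a > 1`, integers `r ≥ 1`, `m ≥ 1` with `a - 1 ≤ r`, a tuple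
`(c_1,…,c_{k-1})` of digits in `{0,…,r}` (of length `p = k - 1`) and `j ∈ {0,…,r-1}`,
the intersection of the adjacent rank-`k` cylinders `Δ_{c_1…c_p j}` and
`Δ_{c_1…c_p (j+1)}` equals the single rank-`(k+m)` cylinder `Δ_{c_1…c_p j r…r}`
(with `m` copies of the digit `r` appended) if and only if
`r = a^m (a-1) / (a^m - 1)`. -/
theorem stmt_13 (a : ℝ) (ha : 1 < a) (r : ℕ) (hr : 1 ≤ r) (har : a - 1 ≤ r)
    (m : ℕ) (hm : 1 ≤ m)
    (p : ℕ) (c : ℕ → ℕ) (hc : ∀ i, i < p → c i ≤ r) (j : ℕ) (hj : j < r) :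
    (raCylinder a r (p + 1) (fun i => if i = p then j else c i) ∩
        raCylinder a r (p + 1) (fun i => if i = p then j + 1 else c i) =
      raCylinder a r (p + 1 + m)
        (fun i => if i < p then c i else if i = p then j else r)) ↔
      (r : ℝ) = a ^ m * (a - 1) / (a ^ m - 1) := by
  have h0 : 0 < a := by linarith
  have h1 : 0 < a - 1 := by linarith
  have ham : 0 < a ^ m - 1 := by linarith [one_lt_pow₀ ha (by omega : m ≠ 0)]
  have hprefix : ∀ d : ℕ, ∑ i ∈ range (p + 1), ((if i = p then d else c i : ℕ) : ℝ) / a ^ (i + 1) =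
      ∑ i ∈ range p, (c i : ℝ) / a ^ (i + 1) + d / a ^ (p + 1) := fun d => by
    rw [sum_range_succ, if_pos rfl]
    congr 1
    refine sum_congr rfl fun i hi => ?_
    rw [if_neg (mem_range.1 hi).ne]
  have hlong : ∑ i ∈ range (p + 1 + m),
      ((if i < p then c i else if i = p then j else r : ℕ) : ℝ) / a ^ (i + 1) =
      ∑ i ∈ range p, (c i : ℝ) / a ^ (i + 1) + j / a ^ (p + 1) +
        (r / (a ^ (p + 1) * (a - 1)) - r / (a ^ (p + 1 + m) * (a - 1))) := by
    rw [sum_range_add, ← sum_range_const_div_pow ha, ← hprefix]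
    congr 1
    · refine sum_congr rfl fun i hi => ?_
      have := mem_range.1 hi
      congr 2
      split_ifs <;> first | rfl | omega
    · refine sum_congr rfl fun i _ => ?_
      rw [if_neg (by omega), if_neg (by omega)]
  rw [raCylinder_eq_Icc ha har, raCylinder_eq_Icc ha har, raCylinder_eq_Icc ha har,
    hprefix, hprefix, hlong, Set.Icc_inter_Icc]
  set S := ∑ i ∈ range p, (c i : ℝ) / a ^ (i + 1)
  have hj1 : ((j + 1 : ℕ) : ℝ) / a ^ (p + 1) = j / a ^ (p + 1) + 1 / a ^ (p + 1) := by
    push_cast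
    ring
  have hpos : 0 < 1 / a ^ (p + 1) := by positivity
  have hlen : 1 / a ^ (p + 1) ≤ (r : ℝ) / (a ^ (p + 1) * (a - 1)) := by
    rw [div_le_div_iff₀ (by positivity) (by positivity), one_mul, mul_comm]
    exact mul_le_mul_of_nonneg_right har (by positivity)
  have hlast : 0 ≤ (r : ℝ) / (a ^ (p + 1 + m) * (a - 1)) := by positivity
  have hcond : 1 / a ^ (p + 1) =
      (r : ℝ) / (a ^ (p + 1) * (a - 1)) - r / (a ^ (p + 1 + m) * (a - 1)) ↔
      (r : ℝ) = a ^ m * (a - 1) / (a ^ m - 1) := by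
    rw [eq_div_iff ham.ne', pow_add a (p + 1) m]
    field_simp
    constructor <;> intro h <;> linarith
  rw [hj1, ← hcond, sup_eq_right.2 (by linarith), inf_eq_left.2 (by linarith),
    Set.Icc_eq_Icc_iff (by linarith)]
  constructor
  · rintro ⟨h, -⟩
    linarith
  · intro h
    constructor <;> linarith
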